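/- Let X = MD(G, S0, S1, T0, T1) be a strongly connected mixed Cayley digraph. Then λ(X) < δ(X) if and only if at least one of the following four conditions holds. Condition 1: there exist a proper subgroup H of G with |H| < δ(X), an element s0 ∈ S0 with ⟨(S0 ∪ {1_G}) \ {s0}⟩ ≤ H, and an element t0 ∈ T0 with ⟨S1⟩ ≤ t0·H·t0⁻¹, T1⁻¹·t0 ⊆ H, and t0⁻¹·T0 ⊆ H. Condition 2: there exist a proper subgroup H of G with ⟨S0⟩ ≤ H and |H| < δ(X), and two distinct elements t0, t0' ∈ T0 with ⟨S1⟩ ≤ t0·H·t0⁻¹, T1⁻¹·t0 ⊆ H, t0'·H ∩ t0·H = ∅, and t0⁻¹·(T0 \ {t0'}) ⊆ H. Condition 3: there exist a proper subgroup H of G with |H| < δ(X), an element s1 ∈ S1 with ⟨(S1 ∪ {1_G}) \ {s1}⟩ ≤ H, and an element t1 ∈ T1 with ⟨S0⟩ ≤ t1⁻¹·H·t1, T0·t1⁻¹ ⊆ H, and t1·T1⁻¹ ⊆ H. Condition 4: there exist a proper subgroup H of G with ⟨S1⟩ ≤ H and |H| < δ(X), and two distinct elements t1, t1' ∈ T1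 with ⟨S0⟩ ≤ t1⁻¹·H·t1, T0·t1⁻¹ ⊆ H, t1'⁻¹·H ∩ t1⁻¹·H = ∅, and t1·(T1⁻¹ \ {t1'⁻¹}) ⊆ H. -/

import Mathlib

open Set Pointwise

/-- Arc relation of the mixed Cayley digraph `MD(G,S0,S1,T0,T1)` on vertex set
`G × Bool`, where `false` plays the role of the index `0` and `true` of `1`. -/
def MDArc {G : Type*} [Group G] (S0 S1 T0 T1 : Set G) (u v : G × Bool) : Prop :=
  (u.2 = false ∧ v.2 = false ∧ ∃ s ∈ S0, v.1 = s * u.1) ∨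
  (u.2 = true ∧ v.2 = true ∧ ∃ s ∈ S1, v.1 = s * u.1) ∨
  (u.2 = false ∧ v.2 = true ∧ ∃ t ∈ T0, v.1 = t * u.1) ∨
  (u.2 = true ∧ v.2 = false ∧ ∃ t ∈ T1, u.1 = t * v.1)

/-- A digraph (given by its arc relation) is strongly connected if every vertex
is reachable from every other vertex by a directed path. -/
def DigraphStronglyConnected {V : Type*} (R : V → V → Prop) : Prop :=
  ∀ u v : V, Relation.ReflTransGen R u v

/-- Out-degree of a vertex: the number of arcs originating at it. -/
noncomputable def outDegree {V : Type*} (R : V → V → Prop) (v : V) : ℕ :=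
  {w | R v w}.ncard

/-- In-degree of a vertex: the number of arcs terminating at it. -/
noncomputable def inDegree {V : Type*} (R : V → V → Prop) (v : V) : ℕ :=
  {w | R w v}.ncard

/-- `δ`: the minimum, over all vertices, of in-degrees and out-degrees. -/
noncomputable def minDegree {V : Type*} (R : V → V → Prop) : ℕ :=
  sInf {n | ∃ v, n = outDegree R v ∨ n = inDegree R v}

/-- `W` is an arc-disconnecting set: a set of arcs whose deletion leaves a
digraph that is not strongly connected. -/
def IsDisconnectingArcSet {V : Type*} (R : V → V → Prop) (W : Set (V × V)) : Prop :=
  (∀ p ∈ W, R p.1 p.2) ∧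
  ¬ DigraphStronglyConnected (fun u v => R u v ∧ (u, v) ∉ W)

/-- The arc connectivity `λ`: the minimum cardinality of an arc-disconnecting set. -/
noncomputable def arcConnectivity {V : Type*} (R : V → V → Prop) : ℕ :=
  sInf {n | ∃ W : Set (V × V), IsDisconnectingArcSet R W ∧ W.ncard = n}

/-- `ω⁺(A)`: the set of arcs from `A` to its complement. -/
def omegaPlus {V : Type*} (R : V → V → Prop) (A : Set V) : Set (V × V) :=
  {p | R p.1 p.2 ∧ p.1 ∈ A ∧ p.2 ∉ A}

/-- `ω⁻(A)`: the set of arcs from the complement of `A` to `A`. -/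
def omegaMinus {V : Type*} (R : V → V → Prop) (A : Set V) : Set (V × V) :=
  {p | R p.1 p.2 ∧ p.1 ∉ A ∧ p.2 ∈ A}

/-- A positive arc fragment: a proper nonempty vertex subset with `|ω⁺(A)| = λ`. -/
def IsPosFragment {V : Type*} (R : V → V → Prop) (A : Set V) : Prop :=
  A.Nonempty ∧ A ≠ Set.univ ∧ (omegaPlus R A).ncard = arcConnectivity R

/-- A negative arc fragment: a proper nonempty vertex subset with `|ω⁻(A)| = λ`. -/
def IsNegFragment {V : Type*} (R : V → V → Prop) (A : Set V) : Prop :=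
  A.Nonempty ∧ A ≠ Set.univ ∧ (omegaMinus R A).ncard = arcConnectivity R

/-- An arc fragment: a positive or negative arc fragment. -/
def IsArcFragment {V : Type*} (R : V → V → Prop) (A : Set V) : Prop :=
  IsPosFragment R A ∨ IsNegFragment R A

/-- A `λ`-atom: an arc fragment of least possible cardinality. -/
def IsLambdaAtom {V : Type*} (R : V → V → Prop) (A : Set V) : Prop :=
  IsArcFragment R A ∧ ∀ B, IsArcFragment R B → A.ncard ≤ B.ncard

/-- A positive `λ`-atom: a positive arc fragment of least possible cardinality
among all arc fragments. -/
def IsPosLambdaAtom {V : Type*} (R : V → V → Prop) (A : Set V) : Prop :=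
  IsPosFragment R A ∧ ∀ B, IsArcFragment R B → A.ncard ≤ B.ncard

/-- A negative `λ`-atom: a negative arc fragment of least possible cardinality
among all arc fragments. -/
def IsNegLambdaAtom {V : Type*} (R : V → V → Prop) (A : Set V) : Prop :=
  IsNegFragment R A ∧ ∀ B, IsArcFragment R B → A.ncard ≤ B.ncard

/-- A `λ`-superatom: an arc fragment with at least two vertices, of least
possible cardinality among arc fragments with at least two vertices. -/
def IsLambdaSuperatom {V : Type*} (R : V → V → Prop) (A : Set V) : Prop :=
  IsArcFragment R A ∧ 2 ≤ A.ncard ∧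
    ∀ B, IsArcFragment R B → 2 ≤ B.ncard → A.ncard ≤ B.ncard

/-- A positive `λ`-superatom. -/
def IsPosLambdaSuperatom {V : Type*} (R : V → V → Prop) (A : Set V) : Prop :=
  IsPosFragment R A ∧ 2 ≤ A.ncard ∧
    ∀ B, IsArcFragment R B → 2 ≤ B.ncard → A.ncard ≤ B.ncard

/-- A negative `λ`-superatom. -/
def IsNegLambdaSuperatom {V : Type*} (R : V → V → Prop) (A : Set V) : Prop :=
  IsNegFragment R A ∧ 2 ≤ A.ncard ∧
    ∀ B, IsArcFragment R B → 2 ≤ B.ncard → A.ncard ≤ B.ncard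

/-- The set of out-arcs of a vertex. -/
def outArcsOf {V : Type*} (R : V → V → Prop) (v : V) : Set (V × V) :=
  {p | R p.1 p.2 ∧ p.1 = v}

/-- The set of in-arcs of a vertex. -/
def inArcsOf {V : Type*} (R : V → V → Prop) (v : V) : Set (V × V) :=
  {p | R p.1 p.2 ∧ p.2 = v}

/-- A digraph is super-`λ` if every minimum arc-disconnecting set is the set of
in-arcs of some vertex or the set of out-arcs of some vertex. -/
def SuperLambda {V : Type*} (R : V → V → Prop) : Prop :=
  ∀ W : Set (V × V), IsDisconnectingArcSet R W → W.ncard = arcConnectivity R →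
    (∃ v, W = outArcsOf R v) ∨ (∃ v, W = inArcsOf R v)


section Digraph

variable {V : Type*} {R : V → V → Prop}

lemma omegaPlus_flip (R : V → V → Prop) (A : Set V) :
    omegaPlus (flip R) A = Prod.swap ⁻¹' omegaPlus R Aᶜ := by
  ext ⟨u, v⟩
  simp only [omegaPlus, flip, mem_ofPred_eq, mem_preimage, Prod.swap, mem_compl_iff, not_not]
  tauto

lemma ncard_omegaPlus_flip (R : V → V → Prop) (A : Set V) :
    (omegaPlus (flip R) A).ncard = (omegaPlus R Aᶜ).ncard := by
  rw [omegaPlus_flip]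
  exact ncard_preimage_of_injective_subset_range Prod.swap_injective
    (by rw [Prod.swap_surjective.range_eq]; exact subset_univ _)

lemma isDisconnectingArcSet_omegaPlus {A : Set V} (hne : A.Nonempty) (huniv : A ≠ univ) :
    IsDisconnectingArcSet R (omegaPlus R A) := by
  refine ⟨fun p hp => hp.1, fun hconn => ?_⟩
  obtain ⟨u, hu⟩ := hne
  obtain ⟨v, hv⟩ := (ne_univ_iff_exists_notMem A).1 huniv
  have hreach : ∀ w, Relation.ReflTransGen
      (fun u v => R u v ∧ (u, v) ∉ omegaPlus R A) u w → w ∈ A := by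
    intro w hw
    induction hw with
    | refl => exact hu
    | tail _ hstep ih =>
      by_contra hnot
      exact hstep.2 ⟨hstep.1, ih, hnot⟩
  exact hv (hreach v (hconn u v))

lemma arcConnectivity_le_ncard_omegaPlus {A : Set V} (hne : A.Nonempty) (huniv : A ≠ univ) :
    arcConnectivity R ≤ (omegaPlus R A).ncard :=
  Nat.sInf_le ⟨_, isDisconnectingArcSet_omegaPlus hne huniv, rfl⟩

lemma exists_ncard_omegaPlus_eq_arcConnectivity [Finite V] [Nontrivial V] (R : V → V → Prop) :
    ∃ A : Set V, A.Nonempty ∧ A ≠ univ ∧ (omegaPlus R A).ncard = arcConnectivity R := by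
  obtain ⟨x, y, hxy⟩ := exists_pair_ne V
  have hx : ({x} : Set V) ≠ univ :=
    (ne_univ_iff_exists_notMem _).2 ⟨y, fun h => hxy h.symm⟩
  have hmem : arcConnectivity R ∈
      {n | ∃ W : Set (V × V), IsDisconnectingArcSet R W ∧ W.ncard = n} :=
    Nat.sInf_mem ⟨_, _, isDisconnectingArcSet_omegaPlus (singleton_nonempty x) hx, rfl⟩
  obtain ⟨W, ⟨_, hW⟩, hcard⟩ := hmem
  simp only [DigraphStronglyConnected, not_forall] at hW
  obtain ⟨u, v, huv⟩ := hW
  set A := {w | Relation.ReflTransGen (fun u v => R u v ∧ (u, v) ∉ W) u w} with hA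
  have hne : A.Nonempty := ⟨u, Relation.ReflTransGen.refl⟩
  have huniv : A ≠ univ := (ne_univ_iff_exists_notMem _).2 ⟨v, huv⟩
  have hsub : omegaPlus R A ⊆ W := by
    rintro ⟨a, b⟩ ⟨hab, ha, hb⟩
    by_contra hnot
    exact hb (Relation.ReflTransGen.tail ha ⟨hab, hnot⟩)
  refine ⟨A, hne, huniv, le_antisymm ?_ (arcConnectivity_le_ncard_omegaPlus hne huniv)⟩
  exact hcard ▸ ncard_le_ncard hsub

lemma ncard_omegaPlus_inter_add_union_le [Finite V] (R : V → V → Prop) (A B : Set V) :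
    (omegaPlus R (A ∩ B)).ncard + (omegaPlus R (A ∪ B)).ncard ≤
      (omegaPlus R A).ncard + (omegaPlus R B).ncard := by
  rw [← ncard_union_add_ncard_inter, ← ncard_union_add_ncard_inter (omegaPlus R A)]
  refine Nat.add_le_add (ncard_le_ncard ?_) (ncard_le_ncard ?_) <;> rintro ⟨u, v⟩ <;>
    simp only [omegaPlus, mem_union, mem_inter_iff, mem_ofPred_eq] <;> tauto

lemma omegaPlus_pos_of_stronglyConnected [Finite V] (hR : DigraphStronglyConnected R)
    {A : Set V} (hne : A.Nonempty) (huniv : A ≠ univ) : 0 < (omegaPlus R A).ncard := by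
  rw [ncard_pos, nonempty_iff_ne_empty]
  intro hempty
  refine (isDisconnectingArcSet_omegaPlus (R := R) hne huniv).2 ?_
  simpa [hempty] using hR

lemma ncard_omegaPlus_preimage {φ : Equiv.Perm V} (hφ : ∀ u v, R (φ u) (φ v) ↔ R u v)
    (A : Set V) : (omegaPlus R (φ ⁻¹' A)).ncard = (omegaPlus R A).ncard := by
  have h : omegaPlus R (φ ⁻¹' A) = (Equiv.prodCongr φ φ) ⁻¹' omegaPlus R A := by
    ext ⟨u, v⟩
    simp [omegaPlus, hφ]
  rw [h]
  exact ncard_preimage_of_injective_subset_range (Equiv.injective _)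
    (by rw [(Equiv.surjective _).range_eq]; exact subset_univ _)

lemma preimage_eq_of_minimal_fragment [Finite V] {A : Set V}
    (hmin : ∀ B : Set V, B.Nonempty → B ≠ univ →
      (omegaPlus R B).ncard ≤ (omegaPlus R A).ncard → A.ncard ≤ B.ncard)
    (hlow : ∀ B : Set V, B.Nonempty → B ≠ univ →
      (omegaPlus R A).ncard ≤ (omegaPlus R B).ncard)
    (hhalf : A.ncard ≤ Aᶜ.ncard) {φ : Equiv.Perm V} (hφ : ∀ u v, R (φ u) (φ v) ↔ R u v)
    (hmeet : (A ∩ φ ⁻¹' A).Nonempty) : φ ⁻¹' A = A := by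
  have hcard : (φ ⁻¹' A).ncard = A.ncard :=
    ncard_preimage_of_injective_subset_range φ.injective
      (by rw [φ.surjective.range_eq]; exact subset_univ _)
  have hinter_pos : 0 < (A ∩ φ ⁻¹' A).ncard := (ncard_pos).2 hmeet
  have hsum := ncard_union_add_ncard_inter A (φ ⁻¹' A)
  have htotal := ncard_add_ncard_compl A
  have hunion : A ∪ φ ⁻¹' A ≠ univ := by
    intro h
    rw [h, ncard_univ] at hsum
    omega
  have hinter : A ∩ φ ⁻¹' A ≠ univ := fun h =>
    hunion (eq_univ_of_subset (inter_subset_left.trans subset_union_left) h)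
  have hsub := ncard_omegaPlus_inter_add_union_le R A (φ ⁻¹' A)
  rw [ncard_omegaPlus_preimage hφ] at hsub
  have hge := hlow _ (hmeet.mono (inter_subset_left.trans subset_union_left)) hunion
  have hle := hmin _ hmeet hinter (by omega)
  have hA : A ∩ φ ⁻¹' A = A := eq_of_subset_of_ncard_le inter_subset_left hle
  exact (eq_of_subset_of_ncard_le (inter_eq_left.1 hA) hcard.le).symm

lemma exists_fragment_block [Finite V] [Nontrivial V] (R : V → V → Prop) :
    ∃ A : Set V, A.Nonempty ∧ A ≠ univ ∧
      ((omegaPlus R A).ncard = arcConnectivity R ∨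
        (omegaPlus (flip R) A).ncard = arcConnectivity R) ∧
      ∀ φ : Equiv.Perm V, (∀ u v, R (φ u) (φ v) ↔ R u v) →
        (A ∩ φ ⁻¹' A).Nonempty → φ ⁻¹' A = A := by
  let F : Set (Set V) := {A | A.Nonempty ∧ A ≠ univ ∧
      ((omegaPlus R A).ncard = arcConnectivity R ∨
        (omegaPlus (flip R) A).ncard = arcConnectivity R)}
  have hF : F.Nonempty := by
    obtain ⟨A, h1, h2, h3⟩ := exists_ncard_omegaPlus_eq_arcConnectivity R
    exact ⟨A, h1, h2, Or.inl h3⟩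
  obtain ⟨A, ⟨hne, huniv, hval⟩, hmin⟩ := exists_min_image F ncard (toFinite F) hF
  have hne_compl : Aᶜ.Nonempty := nonempty_compl.2 huniv
  have huniv_compl : Aᶜ ≠ univ := fun h => hne.ne_empty (compl_univ_iff.1 h)
  have hhalf : A.ncard ≤ Aᶜ.ncard := by
    refine hmin _ ⟨hne_compl, huniv_compl, ?_⟩
    rw [ncard_omegaPlus_flip, compl_compl]
    rw [ncard_omegaPlus_flip] at hval
    exact hval.symm
  have hlow : ∀ B : Set V, B.Nonempty → B ≠ univ →
      arcConnectivity R ≤ (omegaPlus R B).ncard := fun B h1 h2 =>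
    arcConnectivity_le_ncard_omegaPlus h1 h2
  have hlow_flip : ∀ B : Set V, B.Nonempty → B ≠ univ →
      arcConnectivity R ≤ (omegaPlus (flip R) B).ncard := fun B h1 h2 => by
    rw [ncard_omegaPlus_flip]
    exact hlow _ (nonempty_compl.2 h2) fun h => h1.ne_empty (compl_univ_iff.1 h)
  refine ⟨A, hne, huniv, hval, fun φ hφ hmeet => ?_⟩
  rcases hval with hval | hval
  · refine preimage_eq_of_minimal_fragment (R := R) (fun B h1 h2 h3 => ?_) ?_ hhalf hφ hmeet
    · exact hmin B ⟨h1, h2, Or.inl (le_antisymm (hval ▸ h3) (hlow B h1 h2))⟩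
    · rwa [hval]
  · refine preimage_eq_of_minimal_fragment (R := flip R) (fun B h1 h2 h3 => ?_) ?_ hhalf
      (fun u v => hφ v u) hmeet
    · exact hmin B ⟨h1, h2, Or.inr (le_antisymm (hval ▸ h3) (hlow_flip B h1 h2))⟩
    · rwa [hval]

end Digraph

section MixedCayley

variable {G : Type*} [Group G]

lemma flip_MDArc (S0 S1 T0 T1 : Set G) :
    flip (MDArc S0 S1 T0 T1) = MDArc S0⁻¹ S1⁻¹ T1 T0 := by
  have key : ∀ (S : Set G) (g h : G),
      (∃ s ∈ S, g = s * h) ↔ ∃ s ∈ S⁻¹, h = s * g := by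
    intro S g h
    constructor
    · rintro ⟨s, hs, rfl⟩
      exact ⟨s⁻¹, by simpa using hs, by simp⟩
    · rintro ⟨s, hs, rfl⟩
      exact ⟨s⁻¹, hs, by simp⟩
  funext ⟨g, i⟩ ⟨h, j⟩
  have h0 := key S0 g h
  have h1 := key S1 g h
  simp only [flip, MDArc, eq_iff_iff, h0, h1]
  cases i <;> cases j <;> simp

/-- Right translation of the vertices of a mixed Cayley digraph. -/
def rightTranslation (x : G) : Equiv.Perm (G × Bool) :=
  Equiv.prodCongr (Equiv.mulRight x) (Equiv.refl Bool)

@[simp] lemma rightTranslation_apply (x g : G) (i : Bool) :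
    rightTranslation x (g, i) = (g * x, i) := rfl

lemma MDArc_rightTranslation (S0 S1 T0 T1 : Set G) (x : G) (u v : G × Bool) :
    MDArc S0 S1 T0 T1 (rightTranslation x u) (rightTranslation x v) ↔
      MDArc S0 S1 T0 T1 u v := by
  obtain ⟨g, i⟩ := u
  obtain ⟨h, j⟩ := v
  simp [MDArc, ← mul_assoc]

lemma minDegree_MDArc_le_out_false [Finite G] (S0 S1 T0 T1 : Set G) :
    minDegree (MDArc S0 S1 T0 T1) ≤ S0.ncard + T0.ncard := by
  have hdeg : minDegree (MDArc S0 S1 T0 T1) ≤ outDegree (MDArc S0 S1 T0 T1) (1, false) :=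
    Nat.sInf_le ⟨_, Or.inl rfl⟩
  refine hdeg.trans ?_
  have h : {w | MDArc S0 S1 T0 T1 ((1 : G), false) w} ⊆
      (fun s => (s, false)) '' S0 ∪ (fun t => (t, true)) '' T0 := by
    rintro ⟨g, j⟩ hw
    cases j <;> simpa [MDArc] using hw
  refine (ncard_le_ncard h).trans ((ncard_union_le _ _).trans ?_)
  exact Nat.add_le_add ncard_image_le ncard_image_le

lemma minDegree_MDArc_le_out_true [Finite G] (S0 S1 T0 T1 : Set G) :
    minDegree (MDArc S0 S1 T0 T1) ≤ S1.ncard + T1.ncard := by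
  have hdeg : minDegree (MDArc S0 S1 T0 T1) ≤ outDegree (MDArc S0 S1 T0 T1) (1, true) :=
    Nat.sInf_le ⟨_, Or.inl rfl⟩
  refine hdeg.trans ?_
  have h : {w | MDArc S0 S1 T0 T1 ((1 : G), true) w} ⊆
      (fun s => (s, true)) '' S1 ∪ (fun t => (t⁻¹, false)) '' T1 := by
    rintro ⟨g, j⟩ hw
    cases j
    · simp only [MDArc, Bool.true_eq_false, Bool.false_eq_true, false_and, true_and,
        false_or, mem_ofPred_eq] at hw
      obtain ⟨t, ht, h1⟩ := hw
      exact Or.inr ⟨t, ht, by simp [eq_inv_of_mul_eq_one_right h1.symm]⟩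
    · simpa [MDArc] using hw
  refine (ncard_le_ncard h).trans ((ncard_union_le _ _).trans ?_)
  exact Nat.add_le_add ncard_image_le ncard_image_le

lemma minDegree_flip {V : Type*} (R : V → V → Prop) : minDegree (flip R) = minDegree R := by
  have h : {n | ∃ v, n = outDegree (flip R) v ∨ n = inDegree (flip R) v} =
      {n | ∃ v, n = outDegree R v ∨ n = inDegree R v} := by
    ext n
    exact exists_congr fun v => Or.comm
  exact congrArg sInf h

lemma ncard_omegaPlus_MDArc [Finite G] (S0 S1 T0 T1 : Set G) (A0 A1 : Set G)
    (A : Set (G × Bool)) (hA0 : ∀ g, (g, false) ∈ A ↔ g ∈ A0)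
    (hA1 : ∀ g, (g, true) ∈ A ↔ g ∈ A1) :
    (omegaPlus (MDArc S0 S1 T0 T1) A).ncard =
      {p : G × G | p.1 ∈ A0 ∧ p.2 ∈ S0 ∧ p.2 * p.1 ∉ A0}.ncard +
      {p : G × G | p.1 ∈ A0 ∧ p.2 ∈ T0 ∧ p.2 * p.1 ∉ A1}.ncard +
      ({p : G × G | p.1 ∈ A1 ∧ p.2 ∈ S1 ∧ p.2 * p.1 ∉ A1}.ncard +
      {p : G × G | p.1 ∈ A1 ∧ p.2 ∈ T1 ∧ p.2⁻¹ * p.1 ∉ A0}.ncard) := by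
  set P1 := {p : G × G | p.1 ∈ A0 ∧ p.2 ∈ S0 ∧ p.2 * p.1 ∉ A0}
  set P2 := {p : G × G | p.1 ∈ A0 ∧ p.2 ∈ T0 ∧ p.2 * p.1 ∉ A1}
  set P3 := {p : G × G | p.1 ∈ A1 ∧ p.2 ∈ S1 ∧ p.2 * p.1 ∉ A1}
  set P4 := {p : G × G | p.1 ∈ A1 ∧ p.2 ∈ T1 ∧ p.2⁻¹ * p.1 ∉ A0}
  let f (i j : Bool) (p : G × G) : (G × Bool) × (G × Bool) := ((p.1, i), (p.2 * p.1, j))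
  let k (p : G × G) : (G × Bool) × (G × Bool) := ((p.1, true), (p.2⁻¹ * p.1, false))
  have hf : ∀ i j, Function.Injective (f i j) := by
    rintro i j ⟨a, b⟩ ⟨c, d⟩ h
    simp only [f, Prod.mk.injEq, and_true] at h
    obtain ⟨rfl, h⟩ := h
    simpa using h
  have hk : Function.Injective k := by
    rintro ⟨a, b⟩ ⟨c, d⟩ h
    simp only [k, Prod.mk.injEq, and_true] at h
    obtain ⟨rfl, h⟩ := h
    simpa using h
  have hunion : omegaPlus (MDArc S0 S1 T0 T1) A =
      (f false false '' P1 ∪ f false true '' P2) ∪ (f true true '' P3 ∪ k '' P4) := by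
    ext ⟨⟨g, i⟩, ⟨h, j⟩⟩
    cases i <;> cases j
    · simp only [omegaPlus, MDArc, mem_ofPred_eq, hA0, mem_union, mem_image, f, k, P1,
        Prod.mk.injEq, Prod.exists]
      simp
      grind
    · simp only [omegaPlus, MDArc, mem_ofPred_eq, hA0, hA1, mem_union, mem_image, f, k, P2,
        Prod.mk.injEq, Prod.exists]
      simp
      grind
    · simp only [omegaPlus, MDArc, mem_ofPred_eq, hA0, hA1, mem_union, mem_image, f, k, P4,
        Prod.mk.injEq, Prod.exists]
      simp
      constructor
      · rintro ⟨⟨t, ht, rfl⟩, h1, h2⟩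
        exact ⟨t, ⟨h1, ht, by simpa using h2⟩, by simp⟩
      · rintro ⟨t, ⟨h1, ht, h2⟩, rfl⟩
        exact ⟨⟨t, ht, by simp⟩, h1, h2⟩
    · simp only [omegaPlus, MDArc, mem_ofPred_eq, hA1, mem_union, mem_image, f, k, P3,
        Prod.mk.injEq, Prod.exists]
      simp
      grind
  have hd1 : Disjoint (f false false '' P1) (f false true '' P2) := by
    rw [disjoint_left]
    rintro _ ⟨p, _, rfl⟩ ⟨q, _, h⟩
    simp [f] at h
  have hd2 : Disjoint (f true true '' P3) (k '' P4) := by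
    rw [disjoint_left]
    rintro _ ⟨p, _, rfl⟩ ⟨q, _, h⟩
    simp [f, k] at h
  have hd3 : Disjoint (f false false '' P1 ∪ f false true '' P2)
      (f true true '' P3 ∪ k '' P4) := by
    rw [disjoint_left]
    rintro _ (⟨p, _, rfl⟩ | ⟨p, _, rfl⟩) (⟨q, _, h⟩ | ⟨q, _, h⟩) <;> simp [f, k] at h
  rw [hunion, ncard_union_eq hd3, ncard_union_eq hd1, ncard_union_eq hd2,
    ncard_image_of_injective _ (hf _ _), ncard_image_of_injective _ (hf _ _),
    ncard_image_of_injective _ (hf _ _), ncard_image_of_injective _ hk]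

/-- The number of connection elements leading from `H × {0}` out of the block
`H × {0} ∪ tH × {1}`. -/
noncomputable def exitCountZero (S T : Set G) (H : Subgroup G) (t : G) : ℕ :=
  {s ∈ S | s ∉ H}.ncard + {x ∈ T | t⁻¹ * x ∉ H}.ncard

/-- The number of connection elements leading from `tH × {1}` out of the block
`H × {0} ∪ tH × {1}`. -/
noncomputable def exitCountOne (S T : Set G) (H : Subgroup G) (t : G) : ℕ :=
  {s ∈ S | t⁻¹ * s * t ∉ H}.ncard + {x ∈ T | t⁻¹ * x ∉ H}.ncard

/-- The number of connection elements leading out of the block `H × {0} ∪ tH × {1}`. -/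
noncomputable def escapeCount (S0 S1 T0 T1 : Set G) (H : Subgroup G) (t : G) : ℕ :=
  exitCountZero S0 T0 H t + exitCountOne S1 T1 H t

lemma ncard_leftCoset (H : Subgroup G) (t : G) :
    {g : G | t⁻¹ * g ∈ H}.ncard = Nat.card H := by
  have h : {g : G | t⁻¹ * g ∈ H} = (fun h => t * h) '' (H : Set G) := by
    ext g
    simp
  rw [h, ncard_image_of_injective _ (mul_right_injective t)]
  rfl

lemma ncard_omegaPlus_MDArc_block [Finite G] (S0 S1 T0 T1 : Set G) (H : Subgroup G) (t : G)
    (A : Set (G × Bool)) (hA0 : ∀ g, (g, false) ∈ A ↔ g ∈ H)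
    (hA1 : ∀ g, (g, true) ∈ A ↔ t⁻¹ * g ∈ H) :
    (omegaPlus (MDArc S0 S1 T0 T1) A).ncard =
      Nat.card H * escapeCount S0 S1 T0 T1 H t := by
  have e1 : {p : G × G | p.1 ∈ (H : Set G) ∧ p.2 ∈ S0 ∧ p.2 * p.1 ∉ (H : Set G)} =
      (H : Set G) ×ˢ {s ∈ S0 | s ∉ H} := by
    ext ⟨g, s⟩
    simp only [mem_ofPred_eq, mem_prod, SetLike.mem_coe, and_congr_right_iff]
    intro hg _
    rw [H.mul_mem_cancel_right hg]
  have e2 : {p : G × G | p.1 ∈ (H : Set G) ∧ p.2 ∈ T0 ∧ p.2 * p.1 ∉ {g | t⁻¹ * g ∈ H}} =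
      (H : Set G) ×ˢ {x ∈ T0 | t⁻¹ * x ∉ H} := by
    ext ⟨g, s⟩
    simp only [mem_ofPred_eq, mem_prod, SetLike.mem_coe, and_congr_right_iff]
    intro hg _
    rw [← mul_assoc, H.mul_mem_cancel_right hg]
  have e3 : {p : G × G | p.1 ∈ {g | t⁻¹ * g ∈ H} ∧ p.2 ∈ S1 ∧
      p.2 * p.1 ∉ {g | t⁻¹ * g ∈ H}} =
      {g | t⁻¹ * g ∈ H} ×ˢ {s ∈ S1 | t⁻¹ * s * t ∉ H} := by
    ext ⟨g, s⟩
    simp only [mem_ofPred_eq, mem_prod, and_congr_right_iff]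
    intro hg _
    rw [← H.mul_mem_cancel_right (y := t⁻¹ * s * t) hg]
    simp [mul_assoc]
  have e4 : {p : G × G | p.1 ∈ {g | t⁻¹ * g ∈ H} ∧ p.2 ∈ T1 ∧ p.2⁻¹ * p.1 ∉ (H : Set G)} =
      {g | t⁻¹ * g ∈ H} ×ˢ {x ∈ T1 | t⁻¹ * x ∉ H} := by
    ext ⟨g, s⟩
    simp only [mem_ofPred_eq, mem_prod, SetLike.mem_coe, and_congr_right_iff]
    intro hg _
    rw [← H.inv_mem_iff (x := t⁻¹ * s), ← H.mul_mem_cancel_right (y := (t⁻¹ * s)⁻¹) hg]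
    simp [mul_assoc]
  have hH : (H : Set G).ncard = Nat.card H := rfl
  rw [ncard_omegaPlus_MDArc S0 S1 T0 T1 (H : Set G) {g | t⁻¹ * g ∈ H} A hA0 hA1, e1, e2, e3, e4]
  simp only [ncard_prod, ncard_leftCoset, hH, escapeCount, exitCountZero, exitCountOne]
  ring

lemma ncard_le_card_add_ncard_notMem [Finite G] (S : Set G) (H : Subgroup G) (t : G) :
    S.ncard ≤ Nat.card H + {x ∈ S | t⁻¹ * x ∉ H}.ncard := by
  rw [← ncard_leftCoset H t]
  refine (ncard_le_ncard fun x hx => ?_).trans (ncard_union_le _ _)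
  by_cases h : t⁻¹ * x ∈ H
  · exact Or.inl h
  · exact Or.inr ⟨hx, h⟩

lemma ncard_lt_card_add_ncard_notMem [Finite G] {S : Set G} (hS : (1 : G) ∉ S)
    (H : Subgroup G) : S.ncard < Nat.card H + {x ∈ S | x ∉ H}.ncard := by
  have h := ncard_le_card_add_ncard_notMem (insert 1 S) H 1
  rw [ncard_insert_of_notMem hS] at h
  have e : {x ∈ insert 1 S | (1 : G)⁻¹ * x ∉ H} = {x ∈ S | x ∉ H} := by
    ext x
    simp only [inv_one, one_mul, mem_ofPred_eq, mem_insert_iff]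
    constructor
    · rintro ⟨rfl | hx, hH⟩
      · exact absurd H.one_mem hH
      · exact ⟨hx, hH⟩
    · exact fun hx => ⟨Or.inr hx.1, hx.2⟩
  rw [e] at h
  omega

lemma ncard_conj_lt_card_add_ncard_notMem [Finite G] {S : Set G} (hS : (1 : G) ∉ S)
    (H : Subgroup G) (t : G) :
    S.ncard < Nat.card H + {x ∈ S | t⁻¹ * x * t ∉ H}.ncard := by
  let c : G → G := fun x => t⁻¹ * x * t
  have hc : Function.Injective c := fun x y h => by simpa [c] using h
  have h1 : (1 : G) ∉ c '' S := by
    rintro ⟨x, hx, hx1⟩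
    have : c x = c 1 := by simpa [c] using hx1
    exact hS (hc this ▸ hx)
  have h := ncard_lt_card_add_ncard_notMem h1 H
  have e : {y ∈ c '' S | y ∉ H} = c '' {x ∈ S | t⁻¹ * x * t ∉ H} := by
    ext y
    constructor
    · rintro ⟨⟨x, hx, rfl⟩, hy⟩
      exact ⟨x, ⟨hx, hy⟩, rfl⟩
    · rintro ⟨x, ⟨hx, hy⟩, rfl⟩
      exact ⟨⟨x, hx, rfl⟩, hy⟩
  rwa [e, ncard_image_of_injective _ hc, ncard_image_of_injective _ hc] at h

/-- The subgroup of right translations stabilizing a set of vertices. -/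
def translationStabilizer (A : Set (G × Bool)) : Subgroup G where
  carrier := {x | ∀ g i, (g * x, i) ∈ A ↔ (g, i) ∈ A}
  one_mem' := by simp
  mul_mem' := by
    intro x y hx hy g i
    rw [← mul_assoc, hy, hx]
  inv_mem' := by
    intro x hx g i
    rw [← hx (g * x⁻¹) i, inv_mul_cancel_right]

lemma mem_iff_of_block {A : Set (G × Bool)}
    (hblock : ∀ x : G, (A ∩ rightTranslation x ⁻¹' A).Nonempty → rightTranslation x ⁻¹' A = A)
    {a : G} {i : Bool} (ha : (a, i) ∈ A) (g : G) :
    (g, i) ∈ A ↔ a⁻¹ * g ∈ translationStabilizer A := by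
  constructor
  · intro hg h j
    have := hblock (a⁻¹ * g) ⟨(a, i), ha, by simpa using hg⟩
    rw [Set.ext_iff] at this
    simpa using this (h, j)
  · intro hg
    simpa using (hg a i).2 ha

lemma card_pos_of_finite [Finite G] (H : Subgroup G) : 1 ≤ Nat.card H := Nat.card_pos

lemma le_ncard_omegaPlus_of_one_side_false [Finite G] {S0 S1 T0 T1 : Set G}
    (hS0 : (1 : G) ∉ S0) (hT0 : T0.Nonempty) (H : Subgroup G) (A : Set (G × Bool))
    (hA0 : ∀ g, (g, false) ∈ A ↔ g ∈ H) (hA1 : ∀ g, (g, true) ∉ A) :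
    S0.ncard + T0.ncard ≤ (omegaPlus (MDArc S0 S1 T0 T1) A).ncard := by
  have e1 : {p : G × G | p.1 ∈ (H : Set G) ∧ p.2 ∈ S0 ∧ p.2 * p.1 ∉ (H : Set G)} =
      (H : Set G) ×ˢ {s ∈ S0 | s ∉ H} := by
    ext ⟨g, s⟩
    simp only [mem_ofPred_eq, mem_prod, SetLike.mem_coe, and_congr_right_iff]
    intro hg _
    rw [H.mul_mem_cancel_right hg]
  have e2 : {p : G × G | p.1 ∈ (H : Set G) ∧ p.2 ∈ T0 ∧ p.2 * p.1 ∉ (∅ : Set G)} =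
      (H : Set G) ×ˢ T0 := by
    ext ⟨g, s⟩
    simp
  have hH : (H : Set G).ncard = Nat.card H := rfl
  rw [ncard_omegaPlus_MDArc S0 S1 T0 T1 (H : Set G) ∅ A hA0 (by simpa using hA1), e1, e2,
    ncard_prod, ncard_prod, hH]
  have h1 := ncard_lt_card_add_ncard_notMem hS0 H
  have h2 := (ncard_pos (s := T0)).2 hT0
  have h3 := card_pos_of_finite H
  nlinarith

lemma le_ncard_omegaPlus_of_one_side_true [Finite G] {S0 S1 T0 T1 : Set G}
    (hS1 : (1 : G) ∉ S1) (hT1 : T1.Nonempty) (H : Subgroup G) (A : Set (G × Bool))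
    (hA0 : ∀ g, (g, false) ∉ A) (hA1 : ∀ g, (g, true) ∈ A ↔ g ∈ H) :
    S1.ncard + T1.ncard ≤ (omegaPlus (MDArc S0 S1 T0 T1) A).ncard := by
  have e1 : {p : G × G | p.1 ∈ (H : Set G) ∧ p.2 ∈ S1 ∧ p.2 * p.1 ∉ (H : Set G)} =
      (H : Set G) ×ˢ {s ∈ S1 | s ∉ H} := by
    ext ⟨g, s⟩
    simp only [mem_ofPred_eq, mem_prod, SetLike.mem_coe, and_congr_right_iff]
    intro hg _
    rw [H.mul_mem_cancel_right hg]
  have e2 : {p : G × G | p.1 ∈ (H : Set G) ∧ p.2 ∈ T1 ∧ p.2⁻¹ * p.1 ∉ (∅ : Set G)} =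
      (H : Set G) ×ˢ T1 := by
    ext ⟨g, s⟩
    simp
  have hH : (H : Set G).ncard = Nat.card H := rfl
  rw [ncard_omegaPlus_MDArc S0 S1 T0 T1 ∅ (H : Set G) A (by simpa using hA0) hA1, e1, e2,
    ncard_prod, ncard_prod, hH]
  have h1 := ncard_lt_card_add_ncard_notMem hS1 H
  have h2 := (ncard_pos (s := T1)).2 hT1
  have h3 := card_pos_of_finite H
  nlinarith

lemma exists_subgroup_of_normalized_block [Finite G] {S0 S1 T0 T1 : Set G}
    (hS0 : (1 : G) ∉ S0) (hS1 : (1 : G) ∉ S1) (hT0 : T0.Nonempty) (hT1 : T1.Nonempty)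
    {A : Set (G × Bool)} (hone : ((1 : G), false) ∈ A ∨
      ((∀ g, (g, false) ∉ A) ∧ ((1 : G), true) ∈ A)) (huniv : A ≠ univ)
    (hblock : ∀ x : G, (A ∩ rightTranslation x ⁻¹' A).Nonempty → rightTranslation x ⁻¹' A = A)
    (hpos : 0 < (omegaPlus (MDArc S0 S1 T0 T1) A).ncard)
    (hlt0 : (omegaPlus (MDArc S0 S1 T0 T1) A).ncard < S0.ncard + T0.ncard)
    (hlt1 : (omegaPlus (MDArc S0 S1 T0 T1) A).ncard < S1.ncard + T1.ncard) :
    ∃ H : Subgroup G, H ≠ ⊤ ∧ ∃ t : G, escapeCount S0 S1 T0 T1 H t = 1 ∧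
      Nat.card H = (omegaPlus (MDArc S0 S1 T0 T1) A).ncard := by
  set H := translationStabilizer A
  rcases hone with h0 | ⟨h0, h1⟩
  · have hA0 : ∀ g, (g, false) ∈ A ↔ g ∈ H := fun g => by
      simpa using mem_iff_of_block hblock h0 g
    by_cases hex : ∃ t, (t, true) ∈ A
    · obtain ⟨t, ht⟩ := hex
      have hA1 : ∀ g, (g, true) ∈ A ↔ t⁻¹ * g ∈ H := mem_iff_of_block hblock ht
      have hcount := ncard_omegaPlus_MDArc_block S0 S1 T0 T1 H t A hA0 hA1
      have hk : escapeCount S0 S1 T0 T1 H t = 1 := by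
        rw [hcount] at hpos hlt0 hlt1
        have hk0 := Nat.pos_of_mul_pos_left hpos
        have b0 := ncard_lt_card_add_ncard_notMem hS0 H
        have b1 := ncard_conj_lt_card_add_ncard_notMem hS1 H t
        have b2 := ncard_le_card_add_ncard_notMem T0 H t
        have b3 := ncard_le_card_add_ncard_notMem T1 H t
        have hH := card_pos_of_finite H
        have hdef := escapeCount.eq_1 S0 S1 T0 T1 H t
        rw [exitCountZero, exitCountOne] at hdef
        by_contra hne
        obtain ⟨k, hk⟩ := Nat.exists_eq_add_of_le (show 2 ≤ escapeCount S0 S1 T0 T1 H t by omega)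
        rw [hk] at hlt0 hlt1 hdef
        nlinarith [Nat.mul_le_mul_right k hH]
      refine ⟨H, ?_, t, hk, ?_⟩
      · rintro htop
        refine huniv (eq_univ_of_forall ?_)
        rintro ⟨g, _ | _⟩
        · simp [hA0, htop]
        · simp [hA1, htop]
      · rw [hcount, hk, mul_one]
    · exact absurd (le_ncard_omegaPlus_of_one_side_false hS0 hT0 H A hA0 (not_exists.1 hex))
        hlt0.not_ge
  · have hA1 : ∀ g, (g, true) ∈ A ↔ g ∈ H := fun g => by
      simpa using mem_iff_of_block hblock h1 g
    exact absurd (le_ncard_omegaPlus_of_one_side_true hS1 hT1 H A h0 hA1) hlt1.not_ge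

lemma exists_subgroup_of_block [Finite G] {S0 S1 T0 T1 : Set G}
    (hS0 : (1 : G) ∉ S0) (hS1 : (1 : G) ∉ S1) (hT0 : T0.Nonempty) (hT1 : T1.Nonempty)
    {A : Set (G × Bool)} (hne : A.Nonempty) (huniv : A ≠ univ)
    (hblock : ∀ x : G, (A ∩ rightTranslation x ⁻¹' A).Nonempty → rightTranslation x ⁻¹' A = A)
    (hpos : 0 < (omegaPlus (MDArc S0 S1 T0 T1) A).ncard)
    (hlt0 : (omegaPlus (MDArc S0 S1 T0 T1) A).ncard < S0.ncard + T0.ncard)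
    (hlt1 : (omegaPlus (MDArc S0 S1 T0 T1) A).ncard < S1.ncard + T1.ncard) :
    ∃ H : Subgroup G, H ≠ ⊤ ∧ ∃ t : G, escapeCount S0 S1 T0 T1 H t = 1 ∧
      Nat.card H = (omegaPlus (MDArc S0 S1 T0 T1) A).ncard := by
  obtain ⟨a, ha⟩ : ∃ a : G, ((a, false) ∈ A) ∨ ((∀ g, (g, false) ∉ A) ∧ (a, true) ∈ A) := by
    by_cases h : ∃ a, (a, false) ∈ A
    · exact h.imp fun a ha => Or.inl ha
    · obtain ⟨⟨a, _ | _⟩, ha⟩ := hne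
      · exact absurd ⟨a, ha⟩ h
      · exact ⟨a, Or.inr ⟨not_exists.1 h, ha⟩⟩
  have hcard := ncard_omegaPlus_preimage (MDArc_rightTranslation S0 S1 T0 T1 a) A
  rw [← hcard] at hpos hlt0 hlt1 ⊢
  refine exists_subgroup_of_normalized_block hS0 hS1 hT0 hT1 ?_ ?_ ?_ hpos hlt0 hlt1
  · simpa using ha.imp_right fun h => ⟨fun g => h.1 (g * a), h.2⟩
  · intro h
    rw [preimage_eq_univ_iff, (rightTranslation a).surjective.range_eq] at h
    exact huniv (univ_subset_iff.1 h)
  · rintro x ⟨⟨g, i⟩, h1, h2⟩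
    have h := hblock (a⁻¹ * x * a) ⟨(g * a, i), h1, by simpa [mul_assoc] using h2⟩
    rw [Set.ext_iff] at h
    ext ⟨g', j⟩
    simpa [mul_assoc] using h (g' * a, j)

lemma escapeCount_flip (S0 S1 T0 T1 : Set G) (H : Subgroup G) (t : G) :
    escapeCount S0⁻¹ S1⁻¹ T1 T0 H t = escapeCount S0 S1 T0 T1 H t := by
  have e0 : {s ∈ S0⁻¹ | s ∉ H} = {s ∈ S0 | s ∉ H}⁻¹ := by
    ext s
    simp
  have e1 : {s ∈ S1⁻¹ | t⁻¹ * s * t ∉ H} = {s ∈ S1 | t⁻¹ * s * t ∉ H}⁻¹ := by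
    ext s
    simp only [mem_ofPred_eq, mem_inv]
    rw [← H.inv_mem_iff (x := t⁻¹ * s * t)]
    simp [mul_assoc]
  simp only [escapeCount, exitCountZero, exitCountOne]
  rw [e0, e1, ncard_inv, ncard_inv]
  ring

theorem exists_escapeCount_eq_one_of_arcConnectivity_lt_minDegree [Finite G]
    {S0 S1 T0 T1 : Set G}
    (hS0 : (1 : G) ∉ S0) (hS1 : (1 : G) ∉ S1) (hT0 : T0.Nonempty) (hT1 : T1.Nonempty)
    (hsc : DigraphStronglyConnected (MDArc S0 S1 T0 T1))
    (hlt : arcConnectivity (MDArc S0 S1 T0 T1) < minDegree (MDArc S0 S1 T0 T1)) :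
    ∃ H : Subgroup G, H ≠ ⊤ ∧ Nat.card H < minDegree (MDArc S0 S1 T0 T1) ∧
      ∃ t : G, escapeCount S0 S1 T0 T1 H t = 1 := by
  obtain ⟨A, hne, huniv, hval, hblock⟩ := exists_fragment_block (MDArc S0 S1 T0 T1)
  have hblock' := fun x => hblock (rightTranslation x) (MDArc_rightTranslation S0 S1 T0 T1 x)
  rcases hval with hval | hval
  · have h0 := minDegree_MDArc_le_out_false S0 S1 T0 T1
    have h1 := minDegree_MDArc_le_out_true S0 S1 T0 T1
    obtain ⟨H, hH, t, hk, hc⟩ := exists_subgroup_of_block hS0 hS1 hT0 hT1 hne huniv hblock'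
      (omegaPlus_pos_of_stronglyConnected hsc hne huniv) (by omega) (by omega)
    exact ⟨H, hH, by omega, t, hk⟩
  · have hpos : 0 < (omegaPlus (flip (MDArc S0 S1 T0 T1)) A).ncard := by
      rw [ncard_omegaPlus_flip]
      exact omegaPlus_pos_of_stronglyConnected hsc (nonempty_compl.2 huniv)
        fun h => hne.ne_empty (compl_univ_iff.1 h)
    have h0 := minDegree_MDArc_le_out_false S0⁻¹ S1⁻¹ T1 T0
    have h1 := minDegree_MDArc_le_out_true S0⁻¹ S1⁻¹ T1 T0
    rw [← flip_MDArc, minDegree_flip] at h0 h1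
    rw [flip_MDArc] at hval hpos
    obtain ⟨H, hH, t, hk, hc⟩ := exists_subgroup_of_block (S0 := S0⁻¹) (S1 := S1⁻¹)
      (by simpa using hS0) (by simpa using hS1) hT1 hT0 hne huniv hblock' hpos
      (by omega) (by omega)
    exact ⟨H, hH, by omega, t, by rwa [escapeCount_flip] at hk⟩

theorem arcConnectivity_le_card_of_escapeCount_le_one [Finite G] {S0 S1 T0 T1 : Set G}
    {H : Subgroup G} (hH : H ≠ ⊤) {t : G} (hk : escapeCount S0 S1 T0 T1 H t ≤ 1) :
    arcConnectivity (MDArc S0 S1 T0 T1) ≤ Nat.card H := by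
  let A : Set (G × Bool) := {v | cond v.2 (t⁻¹ * v.1 ∈ H) (v.1 ∈ H)}
  have hne : A.Nonempty := ⟨(1, false), H.one_mem⟩
  have huniv : A ≠ univ := by
    intro h
    exact hH (eq_top_iff.2 fun g _ => (h ▸ mem_univ (g, false) : (g, false) ∈ A))
  have hle := arcConnectivity_le_ncard_omegaPlus (R := MDArc S0 S1 T0 T1) hne huniv
  rw [ncard_omegaPlus_MDArc_block S0 S1 T0 T1 H t A (fun _ => Iff.rfl) (fun _ => Iff.rfl)] at hle
  exact hle.trans (mul_le_of_le_one_right' hk)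

lemma exitCountZero_conj (S T : Set G) (H : Subgroup G) (t : G) :
    exitCountZero S T⁻¹ (MulAut.conj t • H) t⁻¹ = exitCountOne S T H t := by
  have e : {x ∈ T⁻¹ | t⁻¹⁻¹ * x ∉ MulAut.conj t • H} = {x ∈ T | t⁻¹ * x ∉ H}⁻¹ := by
    ext x
    simp only [mem_ofPred_eq, mem_inv, Subgroup.mem_pointwise_smul_iff_inv_smul_mem]
    rw [← H.inv_mem_iff (x := t⁻¹ * x⁻¹)]
    simp [mul_assoc, ← map_inv]
  rw [exitCountZero, e, ncard_inv, exitCountOne]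
  simp [Subgroup.mem_pointwise_smul_iff_inv_smul_mem, ← map_inv]

lemma escapeCount_conj (S0 S1 T0 T1 : Set G) (H : Subgroup G) (t : G) :
    escapeCount S1 S0 T1⁻¹ T0⁻¹ (MulAut.conj t • H) t⁻¹ = escapeCount S0 S1 T0 T1 H t := by
  have h := exitCountZero_conj S0 T0⁻¹ (MulAut.conj t • H) t⁻¹
  rw [map_inv, inv_smul_smul, inv_inv, inv_inv] at h
  rw [escapeCount, escapeCount, exitCountZero_conj, ← h, add_comm]

lemma conj_smul_ne_top {H : Subgroup G} (hH : H ≠ ⊤) (t : G) : MulAut.conj t • H ≠ ⊤ := by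
  intro h
  refine hH (eq_top_iff.2 fun g _ => ?_)
  have hg : MulAut.conj t • g ∈ MulAut.conj t • H := h ▸ Subgroup.mem_top _
  exact Subgroup.smul_mem_pointwise_smul_iff.1 hg

lemma card_conj_smul (H : Subgroup G) (t : G) :
    Nat.card (MulAut.conj t • H : Subgroup G) = Nat.card H :=
  (Nat.card_congr (Subgroup.equivSMul (MulAut.conj t) H).toEquiv).symm

lemma escapeCount_congr (S0 S1 T0 T1 : Set G) {H : Subgroup G} {t t' : G} (h : t⁻¹ * t' ∈ H) :
    exitCountZero S0 T0 H t = exitCountZero S0 T0 H t' ∧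
      exitCountOne S1 T1 H t = exitCountOne S1 T1 H t' := by
  have e1 : ∀ x, t⁻¹ * x ∈ H ↔ t'⁻¹ * x ∈ H := fun x => by
    rw [← H.mul_mem_cancel_left (H.inv_mem h)]
    simp [mul_assoc]
  have e2 : ∀ x, t⁻¹ * x * t ∈ H ↔ t'⁻¹ * x * t' ∈ H := fun x => by
    rw [← H.mul_mem_cancel_right h, ← H.mul_mem_cancel_left (H.inv_mem h)]
    simp [mul_assoc]
  simp [exitCountZero, exitCountOne, e1, e2]

lemma closure_subset_conj_iff (S : Set G) (H : Subgroup G) (t : G) :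
    (Subgroup.closure S : Set G) ⊆ {t} * (H : Set G) * {t}⁻¹ ↔ ∀ s ∈ S, t⁻¹ * s * t ∈ H := by
  have h : {t} * (H : Set G) * {t}⁻¹ = (MulAut.conj t • H : Subgroup G) := by
    ext g
    rw [SetLike.mem_coe, Subgroup.mem_pointwise_smul_iff_inv_smul_mem]
    simp [← map_inv, mul_assoc]
  rw [h, SetLike.coe_subset_coe, Subgroup.closure_le]
  refine forall₂_congr fun s _ => ?_
  rw [SetLike.mem_coe, Subgroup.mem_pointwise_smul_iff_inv_smul_mem]
  simp [← map_inv]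

lemma inv_mul_singleton_subset_iff (T : Set G) (H : Subgroup G) (t : G) :
    T⁻¹ * {t} ⊆ (H : Set G) ↔ ∀ x ∈ T, t⁻¹ * x ∈ H := by
  rw [mul_singleton, image_subset_iff]
  constructor
  · intro h x hx
    simpa using H.inv_mem (h (inv_mem_inv.2 hx))
  · intro h x hx
    simpa using H.inv_mem (h _ hx)

lemma singleton_inv_mul_subset_iff (T : Set G) (H : Subgroup G) (t : G) :
    {t}⁻¹ * T ⊆ (H : Set G) ↔ ∀ x ∈ T, t⁻¹ * x ∈ H := by
  rw [inv_singleton, singleton_mul, image_subset_iff]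
  rfl

lemma singleton_mul_inter_eq_empty_iff (H : Subgroup G) (t t' : G) :
    ({t'} * (H : Set G)) ∩ ({t} * (H : Set G)) = ∅ ↔ t⁻¹ * t' ∉ H := by
  rw [eq_empty_iff_forall_notMem]
  simp only [singleton_mul, image_mul_left, mem_inter_iff, mem_preimage, SetLike.mem_coe, not_and]
  constructor
  · intro h
    exact h t' (by simp)
  · intro h x hx hx'
    exact h (by simpa [mul_assoc] using H.mul_mem hx' (H.inv_mem hx))

lemma closure_union_one_diff_le_iff (S : Set G) (H : Subgroup G) (s : G) :
    Subgroup.closure ((S ∪ {1}) \ {s}) ≤ H ↔ ∀ x ∈ S, x ≠ s → x ∈ H := by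
  rw [Subgroup.closure_le]
  constructor
  · exact fun h x hx hxs => h ⟨Or.inl hx, hxs⟩
  · rintro h x ⟨hx | rfl, hxs⟩
    · exact h x hx hxs
    · exact H.one_mem

lemma ncard_sep_notMem_eq_zero_iff {α : Type*} [Finite α] (S : Set α) (P : α → Prop) :
    {x ∈ S | ¬ P x}.ncard = 0 ↔ ∀ x ∈ S, P x := by
  rw [ncard_eq_zero, eq_empty_iff_forall_notMem]
  simp

lemma exists_of_ncard_sep_not_eq_one {α : Type*} {S : Set α} {P : α → Prop}
    (h : {x ∈ S | ¬ P x}.ncard = 1) : ∃ a ∈ S, ¬ P a ∧ ∀ x ∈ S, x ≠ a → P x := by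
  obtain ⟨a, ha⟩ := ncard_eq_one.1 h
  have haS : a ∈ {x ∈ S | ¬ P x} := ha ▸ mem_singleton a
  refine ⟨a, haS.1, haS.2, fun x hx hxa => ?_⟩
  by_contra hP
  exact hxa (ha ▸ (⟨hx, hP⟩ : x ∈ {x ∈ S | ¬ P x}) : x ∈ ({a} : Set α))

lemma ncard_sep_not_le_one {α : Type*} {S : Set α} {P : α → Prop} {a : α}
    (h : ∀ x ∈ S, x ≠ a → P x) : {x ∈ S | ¬ P x}.ncard ≤ 1 := by
  refine (ncard_le_ncard (t := {a}) fun x hx => ?_).trans (ncard_singleton a).le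
  by_contra hxa
  exact hx.2 (h x hx.1 hxa)

/-- The first two conditions of the characterization, for a given subgroup. -/
def SingleExit (S0 S1 T0 T1 : Set G) (H : Subgroup G) : Prop :=
  (∃ s0 ∈ S0, Subgroup.closure ((S0 ∪ {1}) \ {s0}) ≤ H ∧
    ∃ t0 ∈ T0, (Subgroup.closure S1 : Set G) ⊆ {t0} * (H : Set G) * {t0}⁻¹ ∧
      T1⁻¹ * {t0} ⊆ (H : Set G) ∧ {t0}⁻¹ * T0 ⊆ (H : Set G)) ∨
  (Subgroup.closure S0 ≤ H ∧ ∃ t0 ∈ T0, ∃ t0' ∈ T0, t0 ≠ t0' ∧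
    (Subgroup.closure S1 : Set G) ⊆ {t0} * (H : Set G) * {t0}⁻¹ ∧
    T1⁻¹ * {t0} ⊆ (H : Set G) ∧ ({t0'} * (H : Set G)) ∩ ({t0} * (H : Set G)) = ∅ ∧
    {t0}⁻¹ * (T0 \ {t0'}) ⊆ (H : Set G))

lemma singleExit_of_exitCount [Finite G] {S0 S1 T0 T1 : Set G} (hS0 : (1 : G) ∉ S0)
    (hT0 : T0.Nonempty) {H : Subgroup G} (hcard : Nat.card H < S0.ncard + T0.ncard) {t : G}
    (h0 : exitCountZero S0 T0 H t = 1) (h1 : exitCountOne S1 T1 H t = 0) :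
    SingleExit S0 S1 T0 T1 H := by
  obtain ⟨t0, ht0, htt0⟩ : ∃ t0 ∈ T0, t⁻¹ * t0 ∈ H := by
    by_contra! hnone
    have hT : {x ∈ T0 | t⁻¹ * x ∉ H} = T0 := sep_eq_self_iff_mem_true.2 hnone
    have hT0' := (ncard_pos (s := T0)).2 hT0
    have hS := ncard_lt_card_add_ncard_notMem hS0 H
    rw [exitCountZero, hT] at h0
    omega
  obtain ⟨c0, c1⟩ := escapeCount_congr S0 S1 T0 T1 htt0
  rw [c0, exitCountZero] at h0
  rw [c1, exitCountOne, Nat.add_eq_zero_iff, ncard_sep_notMem_eq_zero_iff,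
    ncard_sep_notMem_eq_zero_iff] at h1
  have hS1 := (closure_subset_conj_iff S1 H t0).2 h1.1
  have hT1 := (inv_mul_singleton_subset_iff T1 H t0).2 h1.2
  rcases Nat.add_eq_one_iff.1 h0 with ⟨ha, hb⟩ | ⟨ha, hb⟩
  · rw [ncard_sep_notMem_eq_zero_iff] at ha
    obtain ⟨t', ht', hnot, hrest⟩ := exists_of_ncard_sep_not_eq_one hb
    refine Or.inr ⟨(Subgroup.closure_le H).2 ha, t0, ht0, t', ht', ?_, hS1, hT1,
      (singleton_mul_inter_eq_empty_iff H t0 t').2 hnot,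
      (singleton_inv_mul_subset_iff _ H t0).2 fun x hx => hrest x hx.1 hx.2⟩
    rintro rfl
    exact hnot (by simp)
  · rw [ncard_sep_notMem_eq_zero_iff] at hb
    obtain ⟨s, hs, -, hrest⟩ := exists_of_ncard_sep_not_eq_one ha
    exact Or.inl ⟨s, hs, (closure_union_one_diff_le_iff S0 H s).2 hrest, t0, ht0, hS1, hT1,
      (singleton_inv_mul_subset_iff _ H t0).2 hb⟩

lemma SingleExit.exists_escapeCount_le_one [Finite G] {S0 S1 T0 T1 : Set G} {H : Subgroup G}
    (h : SingleExit S0 S1 T0 T1 H) : ∃ t, escapeCount S0 S1 T0 T1 H t ≤ 1 := by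
  have hone : ∀ t, (Subgroup.closure S1 : Set G) ⊆ {t} * (H : Set G) * {t}⁻¹ →
      T1⁻¹ * {t} ⊆ (H : Set G) → exitCountOne S1 T1 H t = 0 := by
    intro t hS1 hT1
    rw [closure_subset_conj_iff] at hS1
    rw [inv_mul_singleton_subset_iff] at hT1
    rw [exitCountOne, (ncard_sep_notMem_eq_zero_iff _ _).2 hS1,
      (ncard_sep_notMem_eq_zero_iff _ _).2 hT1]
  rcases h with ⟨s, -, hs, t, -, hS1, hT1, hT0⟩ | ⟨hS0, t, -, t', -, -, hS1, hT1, -, hT0⟩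
  · refine ⟨t, ?_⟩
    rw [closure_union_one_diff_le_iff] at hs
    rw [singleton_inv_mul_subset_iff] at hT0
    rw [escapeCount, hone t hS1 hT1, exitCountZero, (ncard_sep_notMem_eq_zero_iff _ _).2 hT0]
    exact ncard_sep_not_le_one hs
  · refine ⟨t, ?_⟩
    rw [singleton_inv_mul_subset_iff] at hT0
    rw [escapeCount, hone t hS1 hT1, exitCountZero,
      (ncard_sep_notMem_eq_zero_iff S0 (· ∈ H)).2 ((Subgroup.closure_le H).1 hS0), zero_add]
    exact ncard_sep_not_le_one fun x hx hxt => hT0 x ⟨hx, hxt⟩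

theorem arcConnectivity_lt_minDegree_iff_singleExit [Finite G] {S0 S1 T0 T1 : Set G}
    (hS0 : (1 : G) ∉ S0) (hS1 : (1 : G) ∉ S1) (hT0 : T0.Nonempty) (hT1 : T1.Nonempty)
    (hsc : DigraphStronglyConnected (MDArc S0 S1 T0 T1)) :
    arcConnectivity (MDArc S0 S1 T0 T1) < minDegree (MDArc S0 S1 T0 T1) ↔
      ∃ H : Subgroup G, H ≠ ⊤ ∧ Nat.card H < minDegree (MDArc S0 S1 T0 T1) ∧
        (SingleExit S0 S1 T0 T1 H ∨ SingleExit S1 S0 T1⁻¹ T0⁻¹ H) := by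
  constructor
  · intro hlt
    obtain ⟨H, hH, hcard, t, hk⟩ :=
      exists_escapeCount_eq_one_of_arcConnectivity_lt_minDegree hS0 hS1 hT0 hT1 hsc hlt
    have d0 := minDegree_MDArc_le_out_false S0 S1 T0 T1
    have d1 := minDegree_MDArc_le_out_true S0 S1 T0 T1
    rcases Nat.add_eq_one_iff.1 hk with ⟨h0, h1⟩ | ⟨h1, h0⟩
    · refine ⟨MulAut.conj t • H, conj_smul_ne_top hH t, (card_conj_smul H t).trans_lt hcard,
        Or.inr (singleExit_of_exitCount (t := t⁻¹) hS1 hT1.inv ?_ ?_ ?_)⟩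
      · rw [card_conj_smul, ncard_inv]
        omega
      · rw [exitCountZero_conj, h1]
      · have hconj := escapeCount_conj S0 S1 T0 T1 H t
        rw [hk, escapeCount, exitCountZero_conj, h1] at hconj
        omega
    · exact ⟨H, hH, hcard, Or.inl (singleExit_of_exitCount hS0 hT0 (by omega) h1 h0)⟩
  · rintro ⟨H, hH, hcard, h | h⟩
    · obtain ⟨t, ht⟩ := h.exists_escapeCount_le_one
      exact (arcConnectivity_le_card_of_escapeCount_le_one hH ht).trans_lt hcard
    · obtain ⟨t, ht⟩ := h.exists_escapeCount_le_one
      rw [← escapeCount_conj, inv_inv, inv_inv] at ht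
      refine (arcConnectivity_le_card_of_escapeCount_le_one (conj_smul_ne_top hH t) ht).trans_lt ?_
      rwa [card_conj_smul]

end MixedCayley

/-- characterization of the strongly connected mixed Cayley
digraphs which are not max-λ. -/
theorem mixedCayley_not_maxLambda_iff
    {G : Type*} [Group G] [Fintype G] (S0 S1 T0 T1 : Set G)
    (hS0 : (1 : G) ∉ S0) (hS1 : (1 : G) ∉ S1)
    (hT0 : T0.Nonempty) (hT1 : T1.Nonempty)
    (hsc : DigraphStronglyConnected (MDArc S0 S1 T0 T1)) :
    arcConnectivity (MDArc S0 S1 T0 T1) < minDegree (MDArc S0 S1 T0 T1) ↔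
      -- Condition 1
      ((∃ H : Subgroup G, H ≠ ⊤ ∧ Nat.card H < minDegree (MDArc S0 S1 T0 T1) ∧
        ∃ s0 ∈ S0, Subgroup.closure ((S0 ∪ {1}) \ {s0}) ≤ H ∧
        ∃ t0 ∈ T0,
          (Subgroup.closure S1 : Set G) ⊆ {t0} * (H : Set G) * {t0}⁻¹ ∧
          T1⁻¹ * {t0} ⊆ (H : Set G) ∧
          {t0}⁻¹ * T0 ⊆ (H : Set G)) ∨
      -- Condition 2
      (∃ H : Subgroup G, H ≠ ⊤ ∧ Subgroup.closure S0 ≤ H ∧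
        Nat.card H < minDegree (MDArc S0 S1 T0 T1) ∧
        ∃ t0 ∈ T0, ∃ t0' ∈ T0, t0 ≠ t0' ∧
          (Subgroup.closure S1 : Set G) ⊆ {t0} * (H : Set G) * {t0}⁻¹ ∧
          T1⁻¹ * {t0} ⊆ (H : Set G) ∧
          ({t0'} * (H : Set G)) ∩ ({t0} * (H : Set G)) = ∅ ∧
          {t0}⁻¹ * (T0 \ {t0'}) ⊆ (H : Set G)) ∨
      -- Condition 3
      (∃ H : Subgroup G, H ≠ ⊤ ∧ Nat.card H < minDegree (MDArc S0 S1 T0 T1) ∧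
        ∃ s1 ∈ S1, Subgroup.closure ((S1 ∪ {1}) \ {s1}) ≤ H ∧
        ∃ t1 ∈ T1,
          (Subgroup.closure S0 : Set G) ⊆ {t1}⁻¹ * (H : Set G) * {t1} ∧
          T0 * {t1}⁻¹ ⊆ (H : Set G) ∧
          {t1} * T1⁻¹ ⊆ (H : Set G)) ∨
      -- Condition 4
      (∃ H : Subgroup G, H ≠ ⊤ ∧ Subgroup.closure S1 ≤ H ∧
        Nat.card H < minDegree (MDArc S0 S1 T0 T1) ∧
        ∃ t1 ∈ T1, ∃ t1' ∈ T1, t1 ≠ t1' ∧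
          (Subgroup.closure S0 : Set G) ⊆ {t1}⁻¹ * (H : Set G) * {t1} ∧
          T0 * {t1}⁻¹ ⊆ (H : Set G) ∧
          ({t1'}⁻¹ * (H : Set G)) ∩ ({t1}⁻¹ * (H : Set G)) = ∅ ∧
          {t1} * (T1⁻¹ \ {t1'}⁻¹) ⊆ (H : Set G))) := by
  rw [arcConnectivity_lt_minDegree_iff_singleExit hS0 hS1 hT0 hT1 hsc]
  constructor
  · rintro ⟨H, hH, hcard, (h | ⟨h, h'⟩) | (⟨s, hs, hcl, t, ht, h1, h2, h3⟩ |
      ⟨hcl, t, ht, t', ht', hne, h1, h2, h3, h4⟩)⟩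
    · exact Or.inl ⟨H, hH, hcard, h⟩
    · exact Or.inr (Or.inl ⟨H, hH, h, hcard, h'⟩)
    · refine Or.inr (Or.inr (Or.inl ⟨H, hH, hcard, s, hs, hcl, t⁻¹, ht, ?_, ?_, ?_⟩))
      · simpa using h1
      · simpa using h2
      · simpa using h3
    · refine Or.inr (Or.inr (Or.inr ⟨H, hH, hcl, hcard, t⁻¹, ht, t'⁻¹, ht', ?_, ?_, ?_, ?_, ?_⟩))
      · simpa using hne
      · simpa using h1
      · simpa using h2
      · simpa using h3
      · simpa using h4
  · rintro (⟨H, hH, hcard, h⟩ | ⟨H, hH, h, hcard, h'⟩ |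
      ⟨H, hH, hcard, s, hs, hcl, t, ht, h1, h2, h3⟩ |
      ⟨H, hH, hcl, hcard, t, ht, t', ht', hne, h1, h2, h3, h4⟩)
    · exact ⟨H, hH, hcard, Or.inl (Or.inl h)⟩
    · exact ⟨H, hH, hcard, Or.inl (Or.inr ⟨h, h'⟩)⟩
    · refine ⟨H, hH, hcard, Or.inr (Or.inl ⟨s, hs, hcl, t⁻¹, inv_mem_inv.2 ht, ?_, ?_, ?_⟩)⟩
      · simpa using h1
      · simpa using h2
      · simpa using h3
    · refine ⟨H, hH, hcard, Or.inr (Or.inr ⟨hcl, t⁻¹, inv_mem_inv.2 ht, t'⁻¹,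
        inv_mem_inv.2 ht', ?_, ?_, ?_, ?_, ?_⟩)⟩
      · simpa using hne
      · simpa using h1
      · simpa using h2
      · simpa using h3
      · simpa using h4
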